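/- For a bias parameter τ̃ ≥ 0 define S̃_{τ̃} := 1(μ(X, R, U) ≥ c + τ̃·R). Fix a cutoff c_min ∈ [0,1], assume ℙ(R = 1) > 0 and ℙ(X = x, R = r, S̃_{τ̃} = 1) > 0 for every (x, r) in the essential range of (X, R) and every τ̃ under consideration, and define the automated hiring rule S̃^aut_{τ̃}(x, r) := 1(E[Y | X = x, R = r, S̃_{τ̃} = 1] ≥ c_min). Then for any τ̃ < τ̃′ and any x, S̃^aut_{τ̃}(x, 1) ≤ S̃^aut_{τ̃′}(x, 1), and consequently the fraction of group R = 1 hired, E[S̃^aut_{τ̃}(X, R) | R = 1], is weakly increasing in τ̃ (Corollary 3, aggregate part). -/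

import Mathlib

open MeasureTheory

/-- Conditional expectation given an event: `E[Z | A] = (∫_A Z dP) / P(A)`. -/
noncomputable def condE {Ω : Type*} [MeasurableSpace Ω] (P : Measure Ω)
    (Z : Ω → ℝ) (A : Set Ω) : ℝ :=
  (∫ ω in A, Z ω ∂P) / (P A).toReal

/-- If `Z` has nonnegative integral over each fibre of a countably valued `U` above `V`, then it has
nonnegative integral over the preimage of `V`. -/
theorem setIntegral_inter_preimage_nonneg {Ω 𝒰 : Type*} [MeasurableSpace Ω] {P : Measure Ω}
    [Countable 𝒰] [MeasurableSpace 𝒰] [MeasurableSingletonClass 𝒰] {U : Ω → 𝒰}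
    (hU : Measurable U) {Z : Ω → ℝ} (hZ : Integrable Z P) {W : Set Ω} (hW : MeasurableSet W)
    {V : Set 𝒰} (hV : ∀ u ∈ V, 0 ≤ ∫ ω in W ∩ U ⁻¹' {u}, Z ω ∂P) :
    0 ≤ ∫ ω in W ∩ U ⁻¹' V, Z ω ∂P := by
  have hunion : W ∩ U ⁻¹' V = ⋃ u : V, W ∩ U ⁻¹' {(u : 𝒰)} := by
    ext ω
    simp
  have hdisj : Pairwise (Function.onFun Disjoint fun u : V => W ∩ U ⁻¹' {(u : 𝒰)}) := by
    intro u v huv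
    refine Set.disjoint_left.2 fun ω hu hv => huv (Subtype.ext ?_)
    exact hu.2.symm.trans hv.2
  rw [hunion, integral_iUnion (fun u => hW.inter (hU (measurableSet_singleton _))) hdisj
    hZ.integrableOn]
  exact tsum_nonneg fun u => hV u u.2

/-- The integral of `Z` minus a constant over a set, in terms of `condE`. -/
theorem setIntegral_sub_const_eq_condE {Ω : Type*} [MeasurableSpace Ω] {P : Measure Ω}
    [IsFiniteMeasure P] {Z : Ω → ℝ} (hZ : Integrable Z P) (k : ℝ) (A : Set Ω) :
    ∫ ω in A, (Z ω - k) ∂P = (condE P Z A - k) * (P A).toReal := by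
  rw [integral_sub hZ.integrableOn (integrable_const k), setIntegral_const, condE, smul_eq_mul,
    Measure.real]
  by_cases hA : P A = 0
  · simp [hA, setIntegral_measure_zero]
  · have : (P A).toReal ≠ 0 := ENNReal.toReal_ne_zero.2 ⟨hA, measure_ne_top P A⟩
    field_simp

/-- Raising the threshold on the fibrewise conditional expectation raises the conditional
expectation over the selected set. -/
theorem condE_threshold_mono {Ω 𝒰 : Type*} [MeasurableSpace Ω] {P : Measure Ω}
    [IsFiniteMeasure P] [Countable 𝒰] [MeasurableSpace 𝒰] [MeasurableSingletonClass 𝒰]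
    {U : Ω → 𝒰} (hU : Measurable U) {Z : Ω → ℝ} (hZ : Integrable Z P) {W : Set Ω}
    (hW : MeasurableSet W) {a b : ℝ} (hab : a ≤ b)
    (hpos : 0 < P (W ∩ U ⁻¹' {u | b ≤ condE P Z (W ∩ U ⁻¹' {u})})) :
    condE P Z (W ∩ U ⁻¹' {u | a ≤ condE P Z (W ∩ U ⁻¹' {u})}) ≤
      condE P Z (W ∩ U ⁻¹' {u | b ≤ condE P Z (W ∩ U ⁻¹' {u})}) := by
  set m : 𝒰 → ℝ := fun u => condE P Z (W ∩ U ⁻¹' {u})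
  set A := W ∩ U ⁻¹' {u | a ≤ m u}
  set B := W ∩ U ⁻¹' {u | b ≤ m u}
  have hBA : B ⊆ A := fun ω hω => ⟨hω.1, hab.trans hω.2⟩
  have hBmeas : MeasurableSet B := hW.inter (hU (Set.to_countable _).measurableSet)
  have hBpos : 0 < (P B).toReal := ENNReal.toReal_pos hpos.ne' (measure_ne_top P B)
  have hApos : 0 < (P A).toReal :=
    ENNReal.toReal_pos (hpos.trans_le (measure_mono hBA)).ne' (measure_ne_top P A)
  have hZsub (k : ℝ) : Integrable (fun ω => Z ω - k) P := hZ.sub (integrable_const k)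
  have hb : b ≤ condE P Z B := by
    have h : 0 ≤ ∫ ω in B, (Z ω - b) ∂P := by
      refine setIntegral_inter_preimage_nonneg hU (hZsub b) hW fun u hu => ?_
      rw [setIntegral_sub_const_eq_condE hZ]
      exact mul_nonneg (sub_nonneg.2 hu) ENNReal.toReal_nonneg
    rw [setIntegral_sub_const_eq_condE hZ] at h
    exact sub_nonneg.1 (nonneg_of_mul_nonneg_left h hBpos)
  have hdiff : ∫ ω in A \ B, (Z ω - condE P Z B) ∂P ≤ 0 := by
    have hAB : A \ B = W ∩ U ⁻¹' {u | a ≤ m u ∧ m u < b} := by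
      ext ω
      simp only [A, B, Set.mem_sdiff, Set.mem_inter_iff, Set.mem_preimage, Set.mem_ofPred_eq, ← not_le]
      tauto
    rw [← neg_nonneg, ← integral_neg, hAB]
    refine setIntegral_inter_preimage_nonneg hU (hZsub _).neg hW fun u hu => ?_
    simp only [Pi.neg_apply]
    rw [integral_neg, setIntegral_sub_const_eq_condE hZ, neg_nonneg]
    exact mul_nonpos_of_nonpos_of_nonneg (sub_nonpos.2 (hu.2.le.trans hb)) ENNReal.toReal_nonneg
  have hA : ∫ ω in A, (Z ω - condE P Z B) ∂P ≤ 0 := by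
    rw [← integral_inter_add_sdiff hBmeas (hZsub _).integrableOn,
      Set.inter_eq_self_of_subset_right hBA, setIntegral_sub_const_eq_condE hZ _ B, sub_self,
      zero_mul, zero_add]
    exact hdiff
  rw [setIntegral_sub_const_eq_condE hZ] at hA
  exact sub_nonpos.1 (nonpos_of_mul_nonpos_left hA hApos)

/-- **Corollary 3, aggregate part.** With the modified selection rule
`S̃_τ̃ := 1(μ(X, R, U) ≥ c + τ̃·R)` and the automated hiring rule
`S̃^aut_τ̃(x, r) := 1(E[Y | X = x, R = r, S̃_τ̃ = 1] ≥ c_min)`, we have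
`S̃^aut_τ̃(x, 1) ≤ S̃^aut_τ̃'(x, 1)` for `τ̃ < τ̃'`, and the fraction of group `R = 1`
hired, `E[S̃^aut_τ̃(X, R) | R = 1]`, is weakly increasing in `τ̃`. -/
theorem fewer_labels_aggregate
    {Ω : Type*} [MeasurableSpace Ω] (P : Measure Ω) [IsProbabilityMeasure P]
    {𝒳 𝒰 : Type*} [Countable 𝒳] [Countable 𝒰]
    [MeasurableSpace 𝒳] [MeasurableSingletonClass 𝒳]
    [MeasurableSpace 𝒰] [MeasurableSingletonClass 𝒰]
    (X : Ω → 𝒳) (U : Ω → 𝒰) (R Y : Ω → ℝ)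
    (hX : Measurable X) (hU : Measurable U) (hR : Measurable R) (hY : Measurable Y)
    (hR01 : ∀ ω, R ω = 0 ∨ R ω = 1) (hY01 : ∀ ω, Y ω = 0 ∨ Y ω = 1)
    -- every point of the essential range of (X, R, U) has positive mass
    (hXRU : ∀ ω, 0 < P {ω' | X ω' = X ω ∧ R ω' = R ω ∧ U ω' = U ω})
    (c : ℝ) (hc : 0 < c)
    -- μ(x, r, u) = E[Y | X = x, R = r, U = u]
    (μ : 𝒳 → ℝ → 𝒰 → ℝ)
    (hμ : ∀ x r u, μ x r u = condE P Y {ω | X ω = x ∧ R ω = r ∧ U ω = u})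
    -- the modified selection indicator S̃_τ̃ = 1(μ(X, R, U) ≥ c + τ̃·R)
    (St : ℝ → Ω → ℝ)
    (hSt : ∀ τ ω, St τ ω = if c + τ * R ω ≤ μ (X ω) (R ω) (U ω) then 1 else 0)
    (cmin : ℝ) (hcmin : cmin ∈ Set.Icc (0 : ℝ) 1)
    (hR1 : 0 < P {ω | R ω = 1})
    -- the automated hiring rule S̃^aut_τ̃(x, r) = 1(E[Y | X = x, R = r, S̃_τ̃ = 1] ≥ c_min)
    (Staut : ℝ → 𝒳 → ℝ → ℝ)
    (hStaut : ∀ t x r, Staut t x r =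
      if cmin ≤ condE P Y {ω | X ω = x ∧ R ω = r ∧ St t ω = 1} then 1 else 0)
    (τt τt' : ℝ) (hτt : 0 ≤ τt) (hτt' : 0 ≤ τt') (hlt : τt < τt')
    -- positivity of the selected sample for every (x, r) in the essential range
    -- of (X, R), at every bias parameter under consideration
    (hpos : ∀ t ∈ ({τt, τt'} : Set ℝ), ∀ x r, 0 < P {ω | X ω = x ∧ R ω = r} →
      0 < P {ω | X ω = x ∧ R ω = r ∧ St t ω = 1}) :
    (∀ x : 𝒳, Staut τt x 1 ≤ Staut τt' x 1) ∧
      condE P (fun ω => Staut τt (X ω) (R ω)) {ω | R ω = 1} ≤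
        condE P (fun ω => Staut τt' (X ω) (R ω)) {ω | R ω = 1} := by
  have hYint : Integrable Y P := by
    refine Integrable.of_bound hY.aestronglyMeasurable 1 (Filter.Eventually.of_forall fun ω => ?_)
    rcases hY01 ω with h | h <;> simp [h]
  have hmono : ∀ x : 𝒳, Staut τt x 1 ≤ Staut τt' x 1 := by
    intro x
    set W : Set Ω := {ω | X ω = x ∧ R ω = 1}
    have hW : MeasurableSet W :=
      (hX (measurableSet_singleton x)).inter (hR (measurableSet_singleton 1))
    have hfibre (u : 𝒰) : μ x 1 u = condE P Y (W ∩ U ⁻¹' {u}) := by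
      rw [hμ]
      congr 1
      ext ω
      simp [W, and_assoc]
    have hsel (t : ℝ) : {ω | X ω = x ∧ R ω = 1 ∧ St t ω = 1} =
        W ∩ U ⁻¹' {u | c + t ≤ condE P Y (W ∩ U ⁻¹' {u})} := by
      ext ω
      simp only [← hfibre, Set.mem_ofPred_eq, Set.mem_inter_iff, Set.mem_preimage, hSt, W, and_assoc]
      refine and_congr_right fun hx => and_congr_right fun hr => ?_
      simp [hx, hr]
    have hle : condE P Y {ω | X ω = x ∧ R ω = 1 ∧ St τt ω = 1} ≤
        condE P Y {ω | X ω = x ∧ R ω = 1 ∧ St τt' ω = 1} := by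
      rcases eq_or_ne (P W) 0 with h0 | h0
      · have hnull (t : ℝ) : P {ω | X ω = x ∧ R ω = 1 ∧ St t ω = 1} = 0 :=
          measure_mono_null (fun ω hω => And.intro hω.1 hω.2.1) h0
        simp [condE, hnull]
      · have hp := hpos τt' (by simp) x 1 (pos_iff_ne_zero.2 h0)
        rw [hsel] at hp
        rw [hsel, hsel]
        exact condE_threshold_mono hU hYint hW (by linarith) hp
    rw [hStaut, hStaut]
    split_ifs with h₁ h₂
    · exact le_rfl
    · exact absurd (h₁.trans hle) h₂
    · exact zero_le_one
    · exact le_rfl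
  refine ⟨hmono, ?_⟩
  have hR1meas : MeasurableSet {ω | R ω = 1} := hR (measurableSet_singleton 1)
  have hcongr (t : ℝ) : ∫ ω in {ω | R ω = 1}, Staut t (X ω) (R ω) ∂P =
      ∫ ω in {ω | R ω = 1}, Staut t (X ω) 1 ∂P :=
    setIntegral_congr_fun hR1meas fun ω (hω : R ω = 1) => by simp only [hω]
  have hint (t : ℝ) : Integrable (fun ω => Staut t (X ω) 1) P := by
    refine Integrable.of_bound
      ((Measurable.of_discrete (f := fun x => Staut t x 1)).comp hX).aestronglyMeasurable 1
      (Filter.Eventually.of_forall fun ω => ?_)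
    rw [hStaut]
    split_ifs <;> simp
  unfold condE
  rw [hcongr, hcongr]
  exact div_le_div_of_nonneg_right
    (setIntegral_mono (hint _).integrableOn (hint _).integrableOn fun ω => hmono (X ω))
    ENNReal.toReal_nonneg
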